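/- arXiv:1504.02403 — 3 statements merged into one kernel-verified Lean document; each statement's English description precedes it below -/
import Mathlib

section
/- R(5,12) ≥ 194; that is, there exists a 2-coloring of the edges of the complete graph K_193 containing no monochromatic K_5 in color 1 and no monochromatic K_12 in color 2. -/
namespace BitmaskRamsey

/-- `f x`, arranged so that weak head reduction evaluates `x` before substituting it into `f`. -/
def withValue {α : Type} (x : ℕ) (f : ℕ → α) : α :=
  Nat.rec (f 0) (fun n _ => f (Nat.succ n)) x

theorem withValue_eq {α : Type} (x : ℕ) (f : ℕ → α) : withValue x f = f x := by
  cases x <;> rfl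

/-- The lowest set bit of a mask, as a power of two. -/
def lowBit (Q : ℕ) : ℕ := Q ^^^ (Q &&& (Q - 1))

/-- The mask `P` with the bits of `N` cleared. -/
def remove (P N : ℕ) : ℕ := Nat.xor P (Nat.land P N)

/-- Greedily choose a clique inside the candidate mask `Q` and toggle its vertices in `R`. The
function `nb` sends `2 ^ v` to the neighbourhood mask of `v`. -/
def peelClique (nb : ℕ → ℕ) (fuel : ℕ) : ℕ → ℕ → ℕ :=
  Nat.rec (fun _ R => R)
    (fun _ ih Q R => Nat.rec R
      (fun q _ => withValue (Nat.xor (Nat.succ q) (Nat.land (Nat.succ q) q)) fun b =>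
        ih (Nat.land (Nat.succ q) (nb b)) (Nat.xor R b)) Q) fuel

/-- Peel `k` greedy cliques off a mask. -/
def peelCliques (nb : ℕ → ℕ) (k : ℕ) : ℕ → ℕ :=
  Nat.rec (fun R => R) (fun _ ih R => withValue R fun r => ih (peelClique nb 200 r r)) k

/-- Check `test` on the non-neighbours in `P` of each vertex of `R`, deleting the vertices from `P`
one after the other. -/
def branch (nb : ℕ → ℕ) (test : ℕ → Bool) (fuel : ℕ) : ℕ → ℕ → Bool :=
  Nat.rec (fun _ _ => false)
    (fun _ ih P R => Nat.rec true
      (fun r _ => withValue (Nat.xor (Nat.succ r) (Nat.land (Nat.succ r) r)) fun b =>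
        withValue (Nat.xor P b) fun P₁ =>
          and (test (Nat.xor P₁ (Nat.land P₁ (nb b)))) (ih P₁ (Nat.xor (Nat.succ r) b))) R) fuel

/-- A branch-and-bound test whose success certifies that the mask `P` has no independent subset of
size `k`; see `noIndep_sound`. -/
def noIndep (nb : ℕ → ℕ) (k : ℕ) : ℕ → Bool :=
  Nat.rec (fun _ => false)
    (fun k ih P => withValue P fun P => branch nb ih 200 P (peelCliques nb k P)) k

theorem peelClique_succ (nb : ℕ → ℕ) (n Q R : ℕ) : peelClique nb (n + 1) Q R =
    if Q = 0 then R else peelClique nb n (Q &&& nb (lowBit Q)) (R ^^^ lowBit Q) := by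
  cases Q with
  | zero => rfl
  | succ q =>
    simp only [peelClique, withValue_eq]
    rfl

theorem peelCliques_succ (nb : ℕ → ℕ) (k R : ℕ) :
    peelCliques nb (k + 1) R = peelCliques nb k (peelClique nb 200 R R) := by
  simp only [peelCliques, withValue_eq]

theorem branch_succ (nb : ℕ → ℕ) (test : ℕ → Bool) (n P R : ℕ) : branch nb test (n + 1) P R =
    if R = 0 then true else
      (test (remove (P ^^^ lowBit R) (nb (lowBit R))) &&
        branch nb test n (P ^^^ lowBit R) (R ^^^ lowBit R)) := by
  cases R with
  | zero => rfl
  | succ r =>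
    simp only [branch, withValue_eq]
    rfl

theorem noIndep_succ (nb : ℕ → ℕ) (k P : ℕ) :
    noIndep nb (k + 1) P = branch nb (noIndep nb k) 200 P (peelCliques nb k P) := by
  simp only [noIndep, withValue_eq]

theorem testBit_remove (P N v : ℕ) :
    (remove P N).testBit v = (P.testBit v && !N.testBit v) := by
  change (P ^^^ (P &&& N)).testBit v = _
  rw [Nat.testBit_xor, Nat.testBit_and]
  cases P.testBit v <;> cases N.testBit v <;> rfl

theorem exists_lowBit_eq_two_pow {Q : ℕ} (hQ : Q ≠ 0) :
    ∃ v, lowBit Q = 2 ^ v ∧ Q.testBit v = true := by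
  induction Q using Nat.strong_induction_on with
  | _ Q ih =>
    obtain ⟨q, rfl | rfl⟩ : ∃ q, Q = 2 * q ∨ Q = 2 * q + 1 := ⟨Q / 2, by omega⟩
    · obtain ⟨v, hv, hb⟩ := ih q (by omega) (by omega)
      refine ⟨v + 1, ?_, ?_⟩
      · have key : lowBit (2 * q) = 2 * lowBit q := by
          refine Nat.eq_of_testBit_eq fun i => ?_
          cases i with
          | zero => simp [lowBit]
          | succ i =>
            have h1 : 2 * q / 2 = q := by omega
            have h2 : (2 * q - 1) / 2 = q - 1 := by omega
            have h3 : 2 * lowBit q / 2 = lowBit q := by omega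
            rw [Nat.testBit_succ (2 * lowBit q), h3]
            simp only [lowBit, Nat.testBit_xor, Nat.testBit_and]
            simp only [Nat.testBit_succ, h1, h2]
        rw [key, hv, pow_succ]; ring
      · rw [Nat.testBit_succ, show 2 * q / 2 = q by omega, hb]
    · refine ⟨0, ?_, by simp⟩
      refine Nat.eq_of_testBit_eq fun i => ?_
      cases i with
      | zero =>
        simp only [lowBit, Nat.testBit_xor, Nat.testBit_and]
        simp
      | succ i =>
        have h1 : (2 * q + 1) / 2 = q := by omega
        simp only [lowBit, Nat.testBit_xor, Nat.testBit_and]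
        simp [Nat.testBit_succ, h1]

theorem testBit_xor_two_pow_of_ne {u v : ℕ} (h : v ≠ u) (P : ℕ) :
    (P ^^^ 2 ^ u).testBit v = P.testBit v := by
  rw [Nat.testBit_xor, Nat.testBit_two_pow_of_ne (Ne.symm h), Bool.xor_false]

section Soundness

variable {nb : ℕ → ℕ} {S : Finset ℕ}

theorem testBit_peelClique_of_forall_ne {w : ℕ} (n : ℕ) (Q R : ℕ)
    (hQ : ∀ v ∈ S, v ≠ w → Q.testBit v = false) {v : ℕ} (hv : v ∈ S) (hvw : v ≠ w)
    (hR : R.testBit v = true) : (peelClique nb n Q R).testBit v = true := by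
  induction n generalizing Q R with
  | zero => exact hR
  | succ n ih =>
    rw [peelClique_succ]
    split_ifs with h0
    · exact hR
    · obtain ⟨u, hu, hub⟩ := exists_lowBit_eq_two_pow h0
      have hvu : v ≠ u := by
        rintro rfl
        simp [hQ v hv hvw] at hub
      refine ih _ _ (fun x hx hxw => ?_) ?_
      · rw [Nat.testBit_and, hQ x hx hxw, Bool.false_and]
      · rw [hu, testBit_xor_two_pow_of_ne hvu, hR]

theorem exists_testBit_peelClique
    (hS : ∀ u ∈ S, ∀ v ∈ S, u ≠ v → (nb (2 ^ u)).testBit v = false) (n Q R : ℕ) :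
    ∃ w, ∀ v ∈ S, v ≠ w → R.testBit v = true → (peelClique nb n Q R).testBit v = true := by
  induction n generalizing Q R with
  | zero => exact ⟨0, fun v _ _ h => h⟩
  | succ n ih =>
    simp only [peelClique_succ]
    split_ifs with h0
    · exact ⟨0, fun v _ _ h => h⟩
    · obtain ⟨u, hu, hub⟩ := exists_lowBit_eq_two_pow h0
      rw [hu]
      by_cases huS : u ∈ S
      · refine ⟨u, fun v hv hvu hR => testBit_peelClique_of_forall_ne (w := u) n _ _ ?_ hv hvu ?_⟩
        · intro x hx hxu
          rw [Nat.testBit_and, hS u huS x hx (Ne.symm hxu), Bool.and_false]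
        · rw [testBit_xor_two_pow_of_ne hvu, hR]
      · obtain ⟨w, hw⟩ := ih (Q &&& nb (2 ^ u)) (R ^^^ 2 ^ u)
        refine ⟨w, fun v hv hvw hR => hw v hv hvw ?_⟩
        rw [testBit_xor_two_pow_of_ne (ne_of_mem_of_not_mem hv huS), hR]

theorem exists_testBit_peelCliques
    (hS : ∀ u ∈ S, ∀ v ∈ S, u ≠ v → (nb (2 ^ u)).testBit v = false) (k R : ℕ) :
    ∃ T : Finset ℕ, T.card ≤ k ∧ ∀ v ∈ S, v ∉ T → R.testBit v = true →
      (peelCliques nb k R).testBit v = true := by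
  induction k generalizing R with
  | zero => exact ⟨∅, by simp, fun v _ _ h => h⟩
  | succ k ih =>
    obtain ⟨w, hw⟩ := exists_testBit_peelClique hS 200 R R
    obtain ⟨T, hT, h⟩ := ih (peelClique nb 200 R R)
    refine ⟨insert w T, (Finset.card_insert_le _ _).trans (by omega), fun v hv hvT hR => ?_⟩
    rw [Finset.mem_insert, not_or] at hvT
    rw [peelCliques_succ]
    exact h v hv hvT.2 (hw v hv hvT.1 hR)

/-- A successful run of `noIndep nb k P` leaves no independent set of size `k` inside `P`. -/
theorem noIndep_sound {k P : ℕ} (h : noIndep nb k P = true) (hk : S.card = k)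
    (hP : ∀ v ∈ S, P.testBit v = true)
    (hS : ∀ u ∈ S, ∀ v ∈ S, u ≠ v → (nb (2 ^ u)).testBit v = false) : False := by
  induction k generalizing P S with
  | zero => exact Bool.false_ne_true h
  | succ k ih =>
    rw [noIndep_succ] at h
    obtain ⟨T, hT, hpeel⟩ := exists_testBit_peelCliques hS k P
    obtain ⟨x, hxS, hxT⟩ := Finset.exists_mem_notMem_of_card_lt_card (s := T) (t := S) (by omega)
    have hx := hpeel x hxS hxT (hP x hxS)
    generalize peelCliques nb k P = R at h hx
    generalize 200 = n at h
    clear hpeel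
    induction n generalizing P R with
    | zero => exact Bool.false_ne_true h
    | succ n ihn =>
      rw [branch_succ, if_neg (by rintro rfl; simp at hx), Bool.and_eq_true] at h
      have hR : R ≠ 0 := by rintro rfl; simp at hx
      obtain ⟨u, hu, hub⟩ := exists_lowBit_eq_two_pow hR
      rw [hu] at h
      by_cases huS : u ∈ S
      · refine ih (S := S.erase u) h.1 (by rw [Finset.card_erase_of_mem huS, hk]; rfl) ?_ ?_
        · intro v hv
          rw [Finset.mem_erase] at hv
          rw [testBit_remove, testBit_xor_two_pow_of_ne hv.1, hP v hv.2,
            hS u huS v hv.2 hv.1.symm]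
          rfl
        · exact fun a ha b hb => hS a (Finset.mem_of_mem_erase ha) b (Finset.mem_of_mem_erase hb)
      · refine ihn (P := P ^^^ 2 ^ u) (fun v hv => ?_) (R := R ^^^ 2 ^ u) ?_ h.2
        · rw [testBit_xor_two_pow_of_ne (ne_of_mem_of_not_mem hv huS), hP v hv]
        · rw [testBit_xor_two_pow_of_ne (ne_of_mem_of_not_mem hxS huS), hx]

end Soundness

/-- Bits `e < 364` record adjacency of inner vertices with difference `e` modulo `182`; bits
`364 ≤ e < 572` record adjacency of an inner and an outer vertex with difference `e` modulo `26`. -/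
def innerMask : ℕ :=
  11655943703322018256878250858570349123458602633327610470259231563896917121325422493065422679421560347399722659553004392390790902431854481137089591289444903055546429387945090

/-- Bits `e < 208` record adjacency of an inner and an outer vertex with difference `e` modulo `26`;
bits `364 ≤ e < 416` record adjacency of outer vertices with difference `e` modulo `26`. -/
def outerMask : ℕ :=
  55580559029342789299512890632145356522034308326304306167154790254450873998449758298105514978676196235793656487024342541279495

/-- The vertex labels: the inner vertices `0, …, 181` and the outer vertices `364, 366, …, 388`. -/
def IsLabel (u : ℕ) : Prop := u < 182 ∨ 364 ≤ u ∧ u < 390 ∧ u % 2 = 0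

/-- Adjacency of vertex labels. -/
def adj (u v : ℕ) : Bool :=
  if u < 182 then
    if v < 182 then innerMask.testBit ((182 + v - u) % 182)
    else outerMask.testBit ((182 + v - u) % 26)
  else
    if v < 182 then outerMask.testBit ((390 + v - u) % 26)
    else outerMask.testBit (364 + (390 + v - u) % 26)

/-- The neighbourhood mask of `u`, as a function of `2 ^ u`. -/
def row (b : ℕ) : ℕ :=
  cond (Nat.ble b (2 ^ 181)) (Nat.shiftRight (Nat.mul innerMask b) 182)
    (Nat.shiftRight (Nat.mul outerMask b) 390)

/-- The mask of the inner vertices whose residue modulo `26` is at least `c`. -/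
def innerFrom (c : ℕ) : ℕ := (2 ^ 26 - 2 ^ c) * ((2 ^ 182 - 1) / (2 ^ 26 - 1))

/-- The mask of the outer vertices. -/
def outerVertices : ℕ := ((2 ^ 26 - 1) / 3) <<< 364

/-- The mask of all vertices other than `u` not adjacent to `u`, as a function of `2 ^ u`. -/
def coRow (b : ℕ) : ℕ := remove (Nat.lor (innerFrom 0) outerVertices) (Nat.lor (row b) b)

/-- The inner adjacencies together with all inner differences of cyclic length more than `d`. -/
def farMask (d : ℕ) : ℕ :=
  innerMask ||| ((2 ^ (181 - 2 * d) - 1) <<< (d + 1) ||| (2 ^ (181 - 2 * d) - 1) <<< (d + 183))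

/-- The neighbourhood in the inner graph encoded by the mask `N`, as a function of `2 ^ u`. -/
def innerRow (N b : ℕ) : ℕ := Nat.shiftRight (Nat.mul N b) 182

/-- There is no independent set of `11` inner vertices containing `0` and `d` in which no two
vertices have cyclic distance more than `d`. -/
def innerTest (d : ℕ) : Bool :=
  innerMask.testBit d || withValue (farMask d) fun N =>
    noIndep (innerRow N) 9 (remove (2 ^ 182 - 1)
      ((innerRow N 1 ||| innerRow N (2 ^ d)) ||| (1 ||| 2 ^ d)))

/-- There is no independent set of `12` vertices containing `364`, `364 + d` and `c` all of whose
inner vertices have residue at least `c` modulo `26`. -/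
def mixedTest (d c : ℕ) : Bool :=
  (row (2 ^ 364)).testBit c || ((row (2 ^ (364 + d))).testBit c ||
    noIndep row 9 (remove (innerFrom c ||| outerVertices)
      ((row (2 ^ 364) ||| row (2 ^ (364 + d)) ||| row (2 ^ c)) |||
        (2 ^ 364 ||| 2 ^ (364 + d) ||| 2 ^ c))))

/-- There is no clique of `5` vertices containing `r`. -/
def cliqueTest (r : ℕ) : Bool :=
  noIndep coRow 4 ((innerFrom 0 ||| outerVertices) &&& row (2 ^ r))

set_option maxHeartbeats 0 in
theorem innerTest_eq_true {d : ℕ} (h₀ : 0 < d) (h : d < 92) : innerTest d = true := by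
  interval_cases d <;> decide +kernel

set_option maxHeartbeats 0 in
theorem mixedTest_eight {c : ℕ} (h : c < 26) : mixedTest 8 c = true := by
  interval_cases c <;> decide +kernel

set_option maxHeartbeats 0 in
theorem mixedTest_ten {c : ℕ} (h : c < 26) : mixedTest 10 c = true := by
  interval_cases c <;> decide +kernel

theorem outerTest : noIndep row 12 outerVertices = true := by decide +kernel

theorem cliqueTest_zero : cliqueTest 0 = true := by decide +kernel

theorem cliqueTest_one : cliqueTest 1 = true := by decide +kernel

theorem cliqueTest_outer : cliqueTest 364 = true := by decide +kernel

theorem innerMask_mod : ∀ e < 364, innerMask.testBit e = innerMask.testBit (e % 182) := by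
  decide +kernel

theorem innerMask_cross : ∀ e < 572, 364 ≤ e →
    innerMask.testBit e = outerMask.testBit (e % 26) := by
  decide +kernel

theorem outerMask_mod : ∀ e < 208, outerMask.testBit e = outerMask.testBit (e % 26) := by
  decide +kernel

theorem outerMask_outer : ∀ e < 416, 364 ≤ e →
    outerMask.testBit e = outerMask.testBit (364 + e % 26) := by
  decide +kernel

theorem innerMask_neg : ∀ e < 182,
    innerMask.testBit e = innerMask.testBit ((182 - e) % 182) := by
  decide +kernel

theorem outerMask_neg : ∀ e < 26, outerMask.testBit e = outerMask.testBit ((26 - e) % 26) := by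
  decide +kernel

theorem outerMask_outer_neg : ∀ e < 26,
    outerMask.testBit (364 + e) = outerMask.testBit (364 + (26 - e) % 26) := by
  decide +kernel

theorem outerMask_eq_false : ∀ e < 26, outerMask.testBit (364 + e) = false ∧ e % 2 = 0 ∧ e ≠ 0 →
    e = 8 ∨ e = 10 ∨ e = 16 ∨ e = 18 := by
  decide +kernel

theorem testBit_innerFrom : ∀ c < 26, ∀ v < 182, c ≤ v % 26 →
    (innerFrom c).testBit v = true := by
  decide +kernel

theorem testBit_outerVertices : ∀ v < 390, 364 ≤ v → v % 2 = 0 →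
    outerVertices.testBit v = true := by
  decide +kernel

theorem testBit_mul_two_pow_shiftRight {m n u : ℕ} (hu : u ≤ n) (v : ℕ) :
    (Nat.shiftRight (Nat.mul m (2 ^ u)) n).testBit v = m.testBit (n + v - u) := by
  change ((m * 2 ^ u) >>> n).testBit v = _
  rw [Nat.testBit_shiftRight, Nat.testBit_mul_two_pow, decide_eq_true (by omega), Bool.true_and]

theorem testBit_row {u v : ℕ} (hu : IsLabel u) (hv : IsLabel v) :
    (row (2 ^ u)).testBit v = adj u v := by
  unfold IsLabel at hu hv
  by_cases h : u < 182
  · have hb : Nat.ble (2 ^ u) (2 ^ 181) = true := by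
      rw [Nat.ble_eq]
      exact Nat.pow_le_pow_right (by norm_num) (by omega)
    rw [row, hb, cond_true, testBit_mul_two_pow_shiftRight (by omega), adj, if_pos h]
    split_ifs with h'
    · exact innerMask_mod _ (by omega)
    · exact innerMask_cross _ (by omega) (by omega)
  · have hb : Nat.ble (2 ^ u) (2 ^ 181) = false := by
      rw [← Bool.not_eq_true, Nat.ble_eq, not_le]
      exact Nat.pow_lt_pow_right (by norm_num) (by omega)
    rw [row, hb, cond_false, testBit_mul_two_pow_shiftRight (by omega), adj, if_neg h]
    split_ifs with h'
    · exact outerMask_mod _ (by omega)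
    · exact outerMask_outer _ (by omega) (by omega)

theorem adj_comm {u v : ℕ} (hu : IsLabel u) (hv : IsLabel v) : adj u v = adj v u := by
  unfold IsLabel at hu hv
  unfold adj
  split_ifs with h h' h'
  · rw [innerMask_neg _ (Nat.mod_lt _ (by norm_num))]
    congr 1
    omega
  · rw [outerMask_neg _ (Nat.mod_lt _ (by norm_num))]
    congr 1
    omega
  · rw [outerMask_neg _ (Nat.mod_lt _ (by norm_num))]
    congr 1
    omega
  · rw [outerMask_outer_neg _ (Nat.mod_lt _ (by norm_num))]
    congr 2
    omega

/-- `S` consists of vertices, and all pairs of distinct elements of `S` have adjacency `c`. -/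
def Homogeneous (c : Bool) (S : Finset ℕ) : Prop :=
  (∀ u ∈ S, IsLabel u) ∧ ∀ u ∈ S, ∀ v ∈ S, u ≠ v → adj u v = c

theorem Homogeneous.mono {c : Bool} {S T : Finset ℕ} (h : Homogeneous c S) (hT : T ⊆ S) :
    Homogeneous c T :=
  ⟨fun u hu => h.1 u (hT hu), fun u hu v hv => h.2 u (hT hu) v (hT hv)⟩

theorem Homogeneous.image {c : Bool} {S : Finset ℕ} (h : Homogeneous c S) {f : ℕ → ℕ}
    (hf : ∀ u ∈ S, IsLabel (f u)) (hadj : ∀ u ∈ S, ∀ v ∈ S, adj (f u) (f v) = adj u v) :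
    Homogeneous c (S.image f) := by
  simp only [Homogeneous, Finset.forall_mem_image]
  exact ⟨hf, fun u hu v hv huv => (hadj u hu v hv).trans (h.2 u hu v hv (ne_of_apply_ne f huv))⟩

/-- The automorphism that rotates the inner vertices by `2 * t` modulo `182` and the outer ones by
`2 * t` modulo `26`. -/
def shift (t u : ℕ) : ℕ := if u < 182 then (u + 2 * t) % 182 else 364 + (u - 364 + 2 * t) % 26

theorem IsLabel.shift {u : ℕ} (hu : IsLabel u) (t : ℕ) : IsLabel (shift t u) := by
  unfold IsLabel BitmaskRamsey.shift at *
  split_ifs <;> omega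

theorem adj_shift {u v : ℕ} (hu : IsLabel u) (hv : IsLabel v) (t : ℕ) :
    adj (shift t u) (shift t v) = adj u v := by
  have hi : ∀ x, (x + 2 * t) % 182 < 182 := fun x => Nat.mod_lt _ (by norm_num)
  have ho : ∀ x, ¬ 364 + x < 182 := fun x => by omega
  unfold IsLabel at hu hv
  unfold adj shift
  by_cases h : u < 182 <;> by_cases h' : v < 182 <;>
    simp only [h, h', hi, ho, if_true, if_false]
  · congr 1
    omega
  · congr 1
    omega
  · congr 1
    omega
  · congr 2
    omega

theorem shift_injOn {S : Finset ℕ} (hS : ∀ u ∈ S, IsLabel u) (t : ℕ) :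
    Set.InjOn (shift t) (S : Set ℕ) := by
  intro u hu v hv huv
  have hu' := hS u hu
  have hv' := hS v hv
  unfold IsLabel at hu' hv'
  unfold shift at huv
  split_ifs at huv <;> omega

theorem Homogeneous.image_shift {c : Bool} {S : Finset ℕ} (h : Homogeneous c S) (t : ℕ) :
    Homogeneous c (S.image (shift t)) :=
  h.image (fun u hu => (h.1 u hu).shift t) fun u hu v hv => adj_shift (h.1 u hu) (h.1 v hv) t

theorem Homogeneous.card_image_shift {c : Bool} {S : Finset ℕ} (h : Homogeneous c S) (t : ℕ) :
    (S.image (shift t)).card = S.card :=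
  Finset.card_image_of_injOn (shift_injOn h.1 t)

theorem testBit_allVertices {v : ℕ} (hv : IsLabel v) :
    (innerFrom 0 ||| outerVertices).testBit v = true := by
  rw [Nat.testBit_or, Bool.or_eq_true]
  rcases hv with hv | ⟨h₁, h₂, h₃⟩
  · exact Or.inl (testBit_innerFrom 0 (by norm_num) v hv (Nat.zero_le _))
  · exact Or.inr (testBit_outerVertices v h₂ h₁ h₃)

theorem testBit_coRow {u v : ℕ} (hu : IsLabel u) (hv : IsLabel v) (h : adj u v = true) :
    (coRow (2 ^ u)).testBit v = false := by
  change (remove _ (row (2 ^ u) ||| 2 ^ u)).testBit v = false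
  rw [testBit_remove, Nat.testBit_or, testBit_row hu hv, h]
  simp

theorem not_homogeneous_true_of_mem {S : Finset ℕ} {r : ℕ} (hr : cliqueTest r = true)
    (hrS : r ∈ S) (hS : Homogeneous true S) : S.card ≠ 5 := by
  intro hcard
  refine noIndep_sound (S := S.erase r) hr (by rw [Finset.card_erase_of_mem hrS, hcard]) ?_ ?_
  · intro v hv
    rw [Finset.mem_erase] at hv
    rw [Nat.testBit_and, testBit_allVertices (hS.1 v hv.2), testBit_row (hS.1 r hrS) (hS.1 v hv.2),
      hS.2 r hrS v hv.2 hv.1.symm]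
    rfl
  · intro u hu v hv huv
    have hu' := Finset.mem_of_mem_erase hu
    have hv' := Finset.mem_of_mem_erase hv
    exact testBit_coRow (hS.1 u hu') (hS.1 v hv') (hS.2 u hu' v hv' huv)

theorem Homogeneous.card_ne_five {S : Finset ℕ} (hS : Homogeneous true S) : S.card ≠ 5 := by
  intro hcard
  obtain ⟨u, hu⟩ : S.Nonempty := Finset.card_pos.1 (by omega)
  have hl := hS.1 u hu
  obtain ⟨t, ht⟩ : ∃ t, shift t u = 0 ∨ shift t u = 1 ∨ shift t u = 364 := by
    unfold IsLabel at hl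
    unfold shift
    by_cases h : u < 182
    · exact ⟨(183 - u) / 2, by rw [if_pos h]; omega⟩
    · exact ⟨(390 - u) / 2, by rw [if_neg h]; omega⟩
  have hmem := Finset.mem_image_of_mem (shift t) hu
  have hcard' := (hS.card_image_shift t).trans hcard
  rcases ht with ht | ht | ht <;> rw [ht] at hmem
  · exact not_homogeneous_true_of_mem cliqueTest_zero hmem (hS.image_shift t) hcard'
  · exact not_homogeneous_true_of_mem cliqueTest_one hmem (hS.image_shift t) hcard'
  · exact not_homogeneous_true_of_mem cliqueTest_outer hmem (hS.image_shift t) hcard'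

/-- The distance of two inner vertices on the cycle of length `182`. -/
def cycDist (u v : ℕ) : ℕ := min ((182 + v - u) % 182) ((182 + u - v) % 182)

theorem testBit_farMask {d e : ℕ} (h : innerMask.testBit e = false) (hd : d ≤ 91)
    (he : e < 364) (hmin : min (e % 182) ((364 - e) % 182) ≤ d) :
    (farMask d).testBit e = false := by
  unfold farMask
  simp only [Nat.testBit_or, h, Nat.testBit_shiftLeft, Nat.testBit_two_pow_sub_one, Bool.false_or,
    Bool.or_eq_false_iff, Bool.and_eq_false_iff, decide_eq_false_iff_not]
  omega

theorem card_ne_eleven_of_mem {S : Finset ℕ} {d : ℕ} (hS : Homogeneous false S)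
    (hlt : ∀ u ∈ S, u < 182) (h₀ : 0 < d) (hd : d ≤ 91) (h0S : 0 ∈ S) (hdS : d ∈ S)
    (hdist : ∀ u ∈ S, ∀ v ∈ S, cycDist u v ≤ d) : S.card ≠ 11 := by
  intro hcard
  have hfar : ∀ u ∈ S, ∀ v ∈ S, u ≠ v → (innerRow (farMask d) (2 ^ u)).testBit v = false := by
    intro u hu v hv huv
    have hu' := hlt u hu
    have hv' := hlt v hv
    have hadj := hS.2 u hu v hv huv
    have hdist' := hdist u hu v hv
    rw [adj, if_pos hu', if_pos hv', ← innerMask_mod _ (by omega)] at hadj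
    rw [innerRow, testBit_mul_two_pow_shiftRight (by omega)]
    refine testBit_farMask hadj hd (by omega) ?_
    unfold cycDist at hdist'
    omega
  have hbit : innerMask.testBit d = false := by
    have := hS.2 0 h0S d hdS h₀.ne
    rw [adj, if_pos (by norm_num), if_pos (by omega), ← innerMask_mod _ (by omega)] at this
    rw [← this, innerMask_mod (182 + d - 0) (by omega)]
    congr 1
    omega
  have htest := innerTest_eq_true h₀ (by omega)
  rw [innerTest, hbit, Bool.false_or, withValue_eq] at htest
  refine noIndep_sound (S := (S.erase 0).erase d) htest ?_ ?_ ?_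
  · rw [Finset.card_erase_of_mem (Finset.mem_erase.2 ⟨h₀.ne', hdS⟩),
      Finset.card_erase_of_mem h0S, hcard]
  · intro v hv
    simp only [Finset.mem_erase] at hv
    have h1 := hfar 0 h0S v hv.2.2 (Ne.symm hv.2.1)
    have h2 := hfar d hdS v hv.2.2 (Ne.symm hv.1)
    have h3 : (2 ^ 0).testBit v = false := Nat.testBit_two_pow_of_ne (Ne.symm hv.2.1)
    rw [pow_zero] at h1 h3
    rw [testBit_remove, Nat.testBit_or, Nat.testBit_or, Nat.testBit_or, h1, h2, h3,
      Nat.testBit_two_pow_of_ne (Ne.symm hv.1), Nat.testBit_two_pow_sub_one,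
      decide_eq_true (hlt v hv.2.2)]
    rfl
  · exact fun u hu v hv => hfar u (Finset.mem_of_mem_erase (Finset.mem_of_mem_erase hu)) v
      (Finset.mem_of_mem_erase (Finset.mem_of_mem_erase hv))

theorem Homogeneous.card_ne_eleven {S : Finset ℕ} (hS : Homogeneous false S)
    (hlt : ∀ u ∈ S, u < 182) : S.card ≠ 11 := by
  intro hcard
  obtain ⟨x, hx, y, hy, hxy⟩ := Finset.one_lt_card.1 (show 1 < S.card by omega)
  obtain ⟨⟨a, b⟩, hab, hmax⟩ := Finset.exists_max_image (S ×ˢ S) (fun p => cycDist p.1 p.2)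
    ⟨(x, y), Finset.mk_mem_product hx hy⟩
  simp only [Finset.mem_product, Prod.forall] at hab hmax
  obtain ⟨d, hd⟩ : ∃ d, cycDist a b = d := ⟨_, rfl⟩
  have hxyd := hmax x y ⟨hx, hy⟩
  have hltx := hlt x hx
  have hlty := hlt y hy
  have hlta := hlt a hab.1
  have hltb := hlt b hab.2
  have h₀ : 0 < d := by unfold cycDist at *; omega
  have hd91 : d ≤ 91 := by unfold cycDist at *; omega
  obtain ⟨p, hp, q, hq, hpq⟩ : ∃ p ∈ S, ∃ q ∈ S, (182 + q - p) % 182 = d := by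
    rcases min_choice ((182 + b - a) % 182) ((182 + a - b) % 182) with h | h
    · exact ⟨a, hab.1, b, hab.2, by rw [← h]; exact hd⟩
    · exact ⟨b, hab.2, a, hab.1, by rw [← h]; exact hd⟩
  have hltp := hlt p hp
  have hltq := hlt q hq
  have hmod : ∀ u, (u + (182 - p)) % 182 < 182 := fun u => Nat.mod_lt _ (by norm_num)
  refine card_ne_eleven_of_mem (S := S.image fun u => (u + (182 - p)) % 182) (d := d)
    (hS.image (fun u _ => Or.inl (hmod u)) ?_) ?_ h₀ hd91 ?_ ?_ ?_ ?_
  · intro u hu v hv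
    have hu' := hlt u hu
    have hv' := hlt v hv
    simp only [adj, hmod, hu', hv', if_true]
    congr 1
    omega
  · simp only [Finset.forall_mem_image]
    exact fun u _ => hmod u
  · exact Finset.mem_image.2 ⟨p, hp, by omega⟩
  · exact Finset.mem_image.2 ⟨q, hq, by omega⟩
  · simp only [Finset.forall_mem_image]
    intro u hu v hv
    have hu' := hlt u hu
    have hv' := hlt v hv
    refine le_trans (le_of_eq ?_) ((hmax u v ⟨hu, hv⟩).trans_eq hd)
    unfold cycDist
    congr 1 <;> omega
  · rw [Finset.card_image_of_injOn, hcard]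
    intro u hu v hv huv
    have hu' := hlt u hu
    have hv' := hlt v hv
    dsimp only at huv
    omega

set_option exponentiation.threshold 400 in
theorem card_ne_twelve_of_inner_mem {S : Finset ℕ} {c d : ℕ} (hS : Homogeneous false S)
    (hc : c < 26) (hd : d = 8 ∨ d = 10) (hcS : c ∈ S) (h364 : 364 ∈ S) (hdS : 364 + d ∈ S)
    (hmin : ∀ v ∈ S, v < 182 → c ≤ v % 26) : S.card ≠ 12 := by
  intro hcard
  have hrow : ∀ u ∈ S, ∀ v ∈ S, u ≠ v → (row (2 ^ u)).testBit v = false :=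
    fun u hu v hv huv => (testBit_row (hS.1 u hu) (hS.1 v hv)).trans (hS.2 u hu v hv huv)
  have htest : mixedTest d c = true := by
    rcases hd with rfl | rfl
    · exact mixedTest_eight hc
    · exact mixedTest_ten hc
  rw [mixedTest, hrow 364 h364 c hcS (by omega), hrow _ hdS c hcS (by omega), Bool.false_or,
    Bool.false_or] at htest
  refine noIndep_sound (S := ((S.erase 364).erase (364 + d)).erase c) htest ?_ ?_ ?_
  · rw [Finset.card_erase_of_mem, Finset.card_erase_of_mem, Finset.card_erase_of_mem h364, hcard]
    · exact Finset.mem_erase.2 ⟨by omega, hdS⟩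
    · exact Finset.mem_erase.2 ⟨by omega, Finset.mem_erase.2 ⟨by omega, hcS⟩⟩
  · intro v hv
    simp only [Finset.mem_erase] at hv
    obtain ⟨hvc, hvd, hv364, hvS⟩ := hv
    have hmask : (innerFrom c ||| outerVertices).testBit v = true := by
      rw [Nat.testBit_or, Bool.or_eq_true]
      rcases hS.1 v hvS with h | ⟨h₁, h₂, h₃⟩
      · exact Or.inl (testBit_innerFrom c hc v h (hmin v hvS h))
      · exact Or.inr (testBit_outerVertices v h₂ h₁ h₃)
    simp only [testBit_remove, Nat.testBit_or (_ ||| _), Nat.testBit_or (row _),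
      Nat.testBit_or (2 ^ _), hmask, hrow 364 h364 v hvS (Ne.symm hv364),
      hrow _ hdS v hvS (Ne.symm hvd), hrow c hcS v hvS (Ne.symm hvc),
      Nat.testBit_two_pow_of_ne (Ne.symm hv364), Nat.testBit_two_pow_of_ne (Ne.symm hvd),
      Nat.testBit_two_pow_of_ne (Ne.symm hvc)]
    rfl
  · intro u hu v hv
    simp only [Finset.mem_erase] at hu hv
    exact hrow u hu.2.2.2 v hv.2.2.2

theorem card_ne_twelve_of_outer_mem {S : Finset ℕ} {d : ℕ} (hS : Homogeneous false S)
    (hd : d = 8 ∨ d = 10) (h364 : 364 ∈ S) (hdS : 364 + d ∈ S) : S.card ≠ 12 := by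
  intro hcard
  rcases (S.filter (· < 182)).eq_empty_or_nonempty with hempty | hne
  · have hout : ∀ v ∈ S, ¬ v < 182 := Finset.filter_eq_empty_iff.1 hempty
    refine noIndep_sound outerTest hcard (fun v hv => ?_) fun u hu v hv huv =>
      (testBit_row (hS.1 u hu) (hS.1 v hv)).trans (hS.2 u hu v hv huv)
    obtain ⟨h₁, h₂, h₃⟩ := (hS.1 v hv).resolve_left (hout v hv)
    exact testBit_outerVertices v h₂ h₁ h₃
  · obtain ⟨x, hx, hmin⟩ := Finset.exists_min_image _ (· % 26) hne
    simp only [Finset.mem_filter] at hx hmin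
    have hxlt := hx.2
    refine card_ne_twelve_of_inner_mem (hS.image_shift (13 * (7 - x / 26))) (c := x % 26)
      (Nat.mod_lt _ (by norm_num)) hd ?_ ?_ ?_ ?_ ((hS.card_image_shift _).trans hcard)
    · refine Finset.mem_image.2 ⟨x, hx.1, ?_⟩
      rw [shift, if_pos hxlt]
      omega
    · refine Finset.mem_image.2 ⟨364, h364, ?_⟩
      rw [shift, if_neg (by omega)]
      omega
    · refine Finset.mem_image.2 ⟨364 + d, hdS, ?_⟩
      rw [shift, if_neg (by omega)]
      omega
    · simp only [Finset.forall_mem_image]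
      intro v hv hlt
      unfold shift at hlt ⊢
      by_cases h : v < 182
      · have := hmin v ⟨hv, h⟩
        rw [if_pos h]
        omega
      · rw [if_neg h] at hlt
        omega

theorem Homogeneous.card_ne_twelve {S : Finset ℕ} (hS : Homogeneous false S) : S.card ≠ 12 := by
  intro hcard
  have hinner : (S.filter (· < 182)).card < 11 := by
    by_contra! h
    obtain ⟨T, hT, hTcard⟩ := Finset.exists_subset_card_eq h
    exact (hS.mono (hT.trans (Finset.filter_subset _ _))).card_ne_eleven
      (fun u hu => (Finset.mem_filter.1 (hT hu)).2) hTcard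
  have hsum := Finset.card_filter_add_card_filter_not (s := S) (· < 182)
  obtain ⟨a, ha, b, hb, hab⟩ :=
    Finset.one_lt_card.1 (show 1 < (S.filter (¬ · < 182)).card by omega)
  rw [Finset.mem_filter] at ha hb
  obtain ⟨p, hp, q, hq, hp', hq', d, hd, hpq⟩ : ∃ p ∈ S, ∃ q ∈ S, ¬ p < 182 ∧ ¬ q < 182 ∧
      ∃ d, (d = 8 ∨ d = 10) ∧ (390 + q - p) % 26 = d := by
    have hadj := hS.2 a ha.1 b hb.1 hab
    have hla := (hS.1 a ha.1).resolve_left ha.2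
    have hlb := (hS.1 b hb.1).resolve_left hb.2
    rw [adj, if_neg ha.2, if_neg hb.2] at hadj
    have := outerMask_eq_false _ (Nat.mod_lt _ (by norm_num)) ⟨hadj, by omega, by omega⟩
    by_cases h : (390 + b - a) % 26 ≤ 10
    · exact ⟨a, ha.1, b, hb.1, ha.2, hb.2, _, by omega, rfl⟩
    · exact ⟨b, hb.1, a, ha.1, hb.2, ha.2, _, by omega, rfl⟩
  have hlp := (hS.1 p hp).resolve_left hp'
  have hlq := (hS.1 q hq).resolve_left hq'
  refine card_ne_twelve_of_outer_mem (hS.image_shift ((390 - p) / 2)) hd ?_ ?_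
    ((hS.card_image_shift _).trans hcard)
  · refine Finset.mem_image.2 ⟨p, hp, ?_⟩
    rw [shift, if_neg hp']
    omega
  · refine Finset.mem_image.2 ⟨q, hq, ?_⟩
    rw [shift, if_neg hq']
    omega

/-- The labels of `193` of the vertices. -/
def label (i : Fin 193) : ℕ := if (i : ℕ) < 182 then i else 2 * i

theorem isLabel_label (i : Fin 193) : IsLabel (label i) := by
  unfold IsLabel label
  split_ifs <;> omega

theorem label_injective : Function.Injective label := by
  intro i j h
  unfold label at h
  split_ifs at h <;> omega

/-- The graph on `193` vertices given by `adj`. -/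
def graph : SimpleGraph (Fin 193) where
  Adj i j := i ≠ j ∧ adj (label i) (label j) = true
  symm := ⟨fun i j h => ⟨h.1.symm, (adj_comm (isLabel_label j) (isLabel_label i)).trans h.2⟩⟩
  loopless := ⟨fun _ h => h.1 rfl⟩

theorem homogeneous_image_label {c : Bool} {s : Finset (Fin 193)}
    (h : ∀ i ∈ s, ∀ j ∈ s, i ≠ j → adj (label i) (label j) = c) :
    Homogeneous c (s.image label) := by
  simp only [Homogeneous, Finset.forall_mem_image]
  exact ⟨fun i _ => isLabel_label i,
    fun i hi j hj hij => h i hi j hj (ne_of_apply_ne label hij)⟩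

theorem graph_cliqueFree : graph.CliqueFree 5 := by
  intro s hs
  refine (homogeneous_image_label fun i hi j hj hij => (hs.isClique hi hj hij).2).card_ne_five ?_
  rw [Finset.card_image_of_injective _ label_injective, hs.card_eq]

theorem graph_compl_cliqueFree : graphᶜ.CliqueFree 12 := by
  intro s hs
  have h : ∀ i ∈ s, ∀ j ∈ s, i ≠ j → adj (label i) (label j) = false := fun i hi j hj hij =>
    Bool.eq_false_iff.2 fun hadj => ((SimpleGraph.compl_adj _ _ _).1 (hs.isClique hi hj hij)).2
      ⟨hij, hadj⟩
  refine (homogeneous_image_label h).card_ne_twelve ?_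
  rw [Finset.card_image_of_injective _ label_injective, hs.card_eq]

end BitmaskRamsey

theorem ramsey_lower_bound_R_5_12 :
    ∃ G : SimpleGraph (Fin 193), G.CliqueFree 5 ∧ Gᶜ.CliqueFree 12 :=
  ⟨BitmaskRamsey.graph, BitmaskRamsey.graph_cliqueFree, BitmaskRamsey.graph_compl_cliqueFree⟩
end

section
/- R(6,9) ≥ 175; that is, there exists a 2-coloring of the edges of the complete graph K_174 containing no monochromatic K_6 in color 1 and no monochromatic K_9 in color 2. -/
namespace CirculantRamsey

/-- `scan S f fuel P` runs through the bits `v` of `P` from the bottom and asks that `f` accepts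
the set, translated by `-v`, of those bits `u > v` for which `u - v` is a bit of `S`. -/
def scan (S : ℕ) (f : ℕ → Bool) : ℕ → ℕ → Bool
  | 0, _ => false
  | _ + 1, 0 => true
  | fuel + 1, p + 1 =>
    match Nat.div p.succ (Nat.sub p.succ (Nat.land p.succ p)) with
    | 0 => false
    | q + 1 => f (Nat.land q.succ S) && scan S f fuel q

/-- `noClique S k P` certifies that no `k` bits of `P` have all their differences among the bits
of `S`. -/
def noClique (S : ℕ) : ℕ → ℕ → Bool
  | 0 => fun _ => false
  | k + 1 => scan S (noClique S k) 177

/-- The search for cliques on `k + 2` vertices in the circulant graph on `ZMod 176` with connection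
set `S`, one difference at a time: once no clique is found through `0` and `d`, the differences
`d` and `-d` are removed from `S`. -/
def noCliqueBy (k : ℕ) : List ℕ → ℕ → Bool
  | [], S => S == 0
  | d :: ds, S =>
    noClique S k (S &&& (S <<< d ||| S >>> (176 - d))) &&
      noCliqueBy k ds (S ^^^ (2 ^ d ||| 2 ^ (176 - d)))

/-- All differences of distinct elements of `s` are bits of `S`. -/
def DiffsIn (S : ℕ) (s : Finset (ZMod 176)) : Prop :=
  ∀ x ∈ s, ∀ y ∈ s, x ≠ y → S.testBit (x - y).val

theorem val_sub_of_lt {x y : ZMod 176} (h : x.val < y.val) :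
    (x - y).val = 176 - y.val + x.val := by
  have hy : y.val < 176 := ZMod.val_lt y
  have hxy : x - y = ((176 - y.val + x.val : ℕ) : ZMod 176) := by
    rw [Nat.cast_add, Nat.cast_sub hy.le, ZMod.natCast_zmod_val, ZMod.natCast_zmod_val,
      ZMod.natCast_self]
    ring
  rw [hxy, ZMod.val_natCast, Nat.mod_eq_of_lt (by omega)]

theorem exists_lowest_bit (p : ℕ) :
    ∃ v, p.succ - (p.succ &&& p) = 2 ^ v ∧ p.succ.testBit v ∧
      ∀ i, p.succ.testBit i → v ≤ i := by
  obtain ⟨v, m, ⟨j, rfl⟩, hp⟩ := Nat.exists_eq_two_pow_mul_odd p.succ_ne_zero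
  have hpos : 0 < 2 ^ v := by positivity
  have hp' : p = 2 ^ v * (2 * j) + (2 ^ v - 1) := by
    rw [mul_add, mul_one] at hp
    omega
  have hbit : ∀ i, p.succ.testBit i = if i < v then false else (2 * j + 1).testBit (i - v) := by
    intro i
    rw [hp]
    simpa using Nat.testBit_two_pow_mul_add (2 * j + 1) hpos i
  have hand : p.succ &&& p = 2 ^ v * (2 * j) := by
    refine Nat.eq_of_testBit_eq fun i => ?_
    have hpi : p.testBit i =
        if i < v then (2 ^ v - 1).testBit i else (2 * j).testBit (i - v) := by
      conv_lhs => rw [hp']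
      exact Nat.testBit_two_pow_mul_add (2 * j) (by omega) i
    have hj := Nat.testBit_two_pow_mul_add (2 * j) hpos i
    rw [add_zero] at hj
    rw [Nat.testBit_and, hbit, hpi, hj]
    split_ifs
    · simp
    · cases i - v <;> simp [Nat.testBit_succ, Nat.mul_add_div]
  refine ⟨v, ?_, ?_, fun i hi => ?_⟩
  · rw [hand, hp, mul_add, mul_one, Nat.add_sub_cancel_left]
  · simp [hbit]
  · by_contra! hlt
    simp [hbit, hlt] at hi

theorem testBit_of_odd_succ {q i : ℕ} (hodd : q.succ.testBit 0) (hi : i ≠ 0) :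
    q.testBit i = q.succ.testBit i := by
  obtain ⟨i, rfl⟩ := Nat.exists_eq_succ_of_ne_zero hi
  rw [Nat.testBit_zero, decide_eq_true_eq] at hodd
  rw [Nat.testBit_succ, Nat.testBit_succ]
  congr 1
  omega

/-- All differences of elements of `s` are bits of `S`. -/
def GapsIn (S : ℕ) (s : Finset ℕ) : Prop :=
  ∀ x ∈ s, ∀ y ∈ s, x < y → S.testBit (y - x)

/-- The elements of `s` are bits of `P`, translated by `c`. -/
def BitsFrom (c P : ℕ) (s : Finset ℕ) : Prop :=
  ∀ x ∈ s, c ≤ x ∧ P.testBit (x - c)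

theorem scan_sound {S k : ℕ} {f : ℕ → Bool}
    (hf : ∀ P, f P → ∀ c s, GapsIn S s → BitsFrom c P s → s.card ≠ k) :
    ∀ fuel P, scan S f fuel P → ∀ c s, GapsIn S s → BitsFrom c P s → s.card ≠ k + 1
  | 0, _, h, _, _, _, _ => by simp [scan] at h
  | _ + 1, 0, _, _, s, _, hP => by
    have : s = ∅ := Finset.eq_empty_of_forall_notMem fun x hx => by simpa using (hP x hx).2
    simp [this]
  | fuel + 1, p + 1, h, c, s, hs, hP => by
    intro hcard
    obtain ⟨v, hv, hvbit, hvle⟩ := exists_lowest_bit p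
    rw [scan] at h
    split at h
    · simp at h
    rename_i q hq
    have hq' : q.succ = p.succ / 2 ^ v := by rw [← hv]; exact hq.symm
    have hqbit : ∀ i, q.succ.testBit i = p.succ.testBit (i + v) := by
      intro i
      rw [hq', Nat.testBit_div_two_pow]
    have hshift : ∀ x ∈ s, c + v ≤ x ∧ q.succ.testBit (x - (c + v)) := by
      intro x hx
      obtain ⟨hcx, hbit⟩ := hP x hx
      have hle := hvle _ hbit
      refine ⟨by omega, ?_⟩
      rw [hqbit, show x - (c + v) + v = x - c by omega]
      exact hbit
    rw [Bool.and_eq_true] at h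
    by_cases hmem : c + v ∈ s
    · refine hf _ h.1 (c + v) (s.erase (c + v))
        (fun x hx y hy => hs x (Finset.mem_of_mem_erase hx) y (Finset.mem_of_mem_erase hy))
        (fun x hx => ?_) (by rw [Finset.card_erase_of_mem hmem, hcard, Nat.add_sub_cancel])
      obtain ⟨hne, hxs⟩ := Finset.mem_erase.1 hx
      obtain ⟨hle, hbit⟩ := hshift x hxs
      refine ⟨hle, (Nat.testBit_and _ _ _).trans ?_⟩
      rw [hbit, hs _ hmem x hxs (lt_of_le_of_ne hle hne.symm), Bool.and_self]
    · refine scan_sound hf fuel q h.2 (c + v) s hs (fun x hx => ?_) hcard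
      obtain ⟨hle, hbit⟩ := hshift x hx
      have hne : x ≠ c + v := fun e => hmem (e ▸ hx)
      refine ⟨hle, ?_⟩
      rwa [testBit_of_odd_succ (by rw [hqbit, zero_add]; exact hvbit) (by omega)]

theorem noClique_sound {S : ℕ} :
    ∀ k P, noClique S k P → ∀ c s, GapsIn S s → BitsFrom c P s → s.card ≠ k
  | 0, _, h => by simp [noClique] at h
  | k + 1, P, h => scan_sound (noClique_sound k) 177 P h

/-- A clique with a pair of difference `d` has a translate through `0` and `d`; its other vertices
are joined to both. -/
theorem sub_ne_of_noClique {S k d : ℕ}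
    (h : noClique S k (S &&& (S <<< d ||| S >>> (176 - d)))) {s : Finset (ZMod 176)}
    (hs : DiffsIn S s) (hcard : s.card = k + 2) {a b : ZMod 176} (ha : a ∈ s) (hb : b ∈ s)
    (hab : a ≠ b) : (b - a).val ≠ d := by
  intro hba
  set t := ((s.erase a).erase b).image fun x => (x - a).val with ht
  have hinj : Function.Injective fun x => (x - a).val :=
    (ZMod.val_injective 176).comp sub_left_injective
  have htcard : t.card = k := by
    rw [ht, Finset.card_image_of_injective _ hinj,
      Finset.card_erase_of_mem (Finset.mem_erase.2 ⟨hab.symm, hb⟩),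
      Finset.card_erase_of_mem ha, hcard]
    omega
  refine noClique_sound k _ h 0 t ?_ ?_ htcard
  · intro x hx y hy hxy
    simp only [ht, Finset.mem_image, Finset.mem_erase] at hx hy
    obtain ⟨x, ⟨-, -, hx⟩, rfl⟩ := hx
    obtain ⟨y, ⟨-, -, hy⟩, rfl⟩ := hy
    rw [← ZMod.val_sub hxy.le, sub_sub_sub_cancel_right]
    exact hs y hy x hx fun e => hxy.ne (e ▸ rfl)
  · intro x hx
    simp only [ht, Finset.mem_image, Finset.mem_erase] at hx
    obtain ⟨x, ⟨hxb, hxa, hx⟩, rfl⟩ := hx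
    refine ⟨Nat.zero_le _, ?_⟩
    rw [Nat.sub_zero]
    have hxab : (x - b) = (x - a) - (b - a) := (sub_sub_sub_cancel_right x b a).symm
    have hSb := hs x hx b hb hxb
    rw [hxab] at hSb
    rw [Nat.testBit_and, hs x hx a ha hxa, Bool.true_and, Nat.testBit_or, Nat.testBit_shiftLeft,
      Nat.testBit_shiftRight]
    rcases lt_or_ge (x - a).val d with hlt | hge
    · rw [val_sub_of_lt (hba ▸ hlt), hba] at hSb
      simp [hSb]
    · rw [ZMod.val_sub (hba ▸ hge), hba] at hSb
      simp [hge, hSb]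

theorem noCliqueBy_sound {k : ℕ} :
    ∀ ds S, noCliqueBy k ds S → ∀ s : Finset (ZMod 176), DiffsIn S s → s.card ≠ k + 2
  | [], S, h, s, hs => by
    intro hcard
    obtain ⟨x, hx, y, hy, hxy⟩ := Finset.one_lt_card.1 (by omega : 1 < s.card)
    rw [noCliqueBy, beq_iff_eq] at h
    simpa [h] using hs x hx y hy hxy
  | d :: ds, S, h, s, hs => by
    intro hcard
    simp only [noCliqueBy, Bool.and_eq_true] at h
    obtain ⟨hfree, hrest⟩ := h
    refine noCliqueBy_sound ds _ hrest s (fun x hx y hy hxy => ?_) hcard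
    have hyx := sub_ne_of_noClique hfree hs hcard hy hx hxy.symm
    have hxy' := sub_ne_of_noClique hfree hs hcard hx hy hxy
    have hneg : (x - y).val ≠ 176 - d := by
      intro e
      have hne : NeZero (x - y) := ⟨sub_ne_zero.2 hxy⟩
      have hpos : (x - y).val ≠ 0 := (ZMod.val_ne_zero _).2 hne.out
      rw [← neg_sub x y, ZMod.val_neg_of_ne_zero, e] at hxy'
      omega
    simp [Nat.testBit_xor, Nat.testBit_or, hs x hx y hy hxy,
      Ne.symm hyx, Ne.symm hneg]

/-- The connection set, as a set of bits; it is symmetric and invariant under multiplication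
by `65`. -/
def conn : ℕ := 10735963739874517593580687854404228208677681941125744

/-- The complement of the connection set in the set of nonzero differences. -/
def coconn : ℕ := conn ^^^ (2 ^ 176 - 2)

theorem noCliqueBy_conn : noCliqueBy 4 ((List.range 89).filter conn.testBit) conn = true := by
  decide +kernel

theorem noCliqueBy_coconn :
    noCliqueBy 7 ((List.range 89).filter coconn.testBit) coconn = true := by
  decide +kernel

theorem testBit_coconn {x : ZMod 176} (hx : x ≠ 0) (h : conn.testBit x.val = false) :
    coconn.testBit x.val := by
  revert x
  decide +kernel

theorem conn_symm (x : ZMod 176) : conn.testBit (-x).val = conn.testBit x.val := by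
  revert x
  decide +kernel

/-- The embedding of the vertices into the cyclic group. -/
def vertex : Fin 174 ↪ ZMod 176 where
  toFun := Fin.castLE (by norm_num : 174 ≤ 176)
  inj' := Fin.castLE_injective _

/-- The subgraph of the circulant graph induced on `174` vertices. -/
def graph : SimpleGraph (Fin 174) where
  Adj i j := i ≠ j ∧ conn.testBit (vertex i - vertex j).val
  symm := ⟨fun i j h => ⟨h.1.symm, by rw [← neg_sub, conn_symm]; exact h.2⟩⟩
  loopless := ⟨fun _ h => h.1 rfl⟩

theorem cliqueFree_of_diffs {k S : ℕ} {H : SimpleGraph (Fin 174)} {ds : List ℕ}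
    (hS : noCliqueBy k ds S) (hH : ∀ i j, H.Adj i j → S.testBit (vertex i - vertex j).val) :
    H.CliqueFree (k + 2) := by
  intro s hs
  refine noCliqueBy_sound ds S hS (s.map vertex) (fun x hx y hy hxy => ?_)
    ((Finset.card_map _).trans hs.card_eq)
  obtain ⟨i, hi, rfl⟩ := Finset.mem_map.1 hx
  obtain ⟨j, hj, rfl⟩ := Finset.mem_map.1 hy
  exact hH i j (hs.isClique hi hj fun e => hxy (e ▸ rfl))

end CirculantRamsey

open CirculantRamsey in
theorem ramsey_lower_bound_R_6_9 :
    ∃ G : SimpleGraph (Fin 174), G.CliqueFree 6 ∧ Gᶜ.CliqueFree 9 := by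
  refine ⟨graph, cliqueFree_of_diffs noCliqueBy_conn fun i j h => h.2,
    cliqueFree_of_diffs noCliqueBy_coconn fun i j h => ?_⟩
  obtain ⟨hij, hadj⟩ := (SimpleGraph.compl_adj _ _ _).1 h
  exact testBit_coconn (sub_ne_zero.2 (vertex.injective.ne hij))
    (Bool.eq_false_iff.2 fun hc => hadj ⟨hij, hc⟩)
end

section
/- R(6,10) ≥ 185; that is, there exists a 2-coloring of the edges of the complete graph K_184 containing no monochromatic K_6 in color 1 and no monochromatic K_10 in color 2. -/
/-! A graph on `Fin 184` invariant under `x ↦ x + 2 (mod 184)` witnesses `R(6, 10) ≥ 185`.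

Vertex sets are stored as the binary digits of a natural number, and cliques are excluded by an
exhaustive search evaluated in the kernel. The search is written with bare recursors and the
`Nat` operations that the kernel evaluates on literals. -/

/-- Process one vertex of the search: `q` is the set of later vertices relative to it, and `w`, `w'`
are the neighbourhood words of its own and of the opposite parity. -/
def branch (next ih : ℕ → ℕ → ℕ → Bool) (q w w' : ℕ) : Bool :=
  Bool.rec false (ih w w' q) (next w w' (Nat.land q w))

/-- `branch` at the lowest element of a set, given the set `t` of the other elements and the value
`b = 2 ^ v` of the lowest digit; `b % 3 = 1` says that `v` is even. -/
def lowestBranch (next ih : ℕ → ℕ → ℕ → Bool) (w w' t b : ℕ) : Bool :=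
  Bool.rec (branch next ih (Nat.div t b) w' w) (branch next ih (Nat.div t b) w w')
    (Nat.beq (Nat.mod b 3) 1)

/-- Run `branch` over all elements of a set in increasing order. -/
def scan (next : ℕ → ℕ → ℕ → Bool) (fuel : ℕ) : ℕ → ℕ → ℕ → Bool :=
  Nat.rec (fun _ _ _ => false) (fun _ ih w w' s =>
    Nat.rec true (fun n _ => lowestBranch next ih w w' (Nat.land (Nat.succ n) n)
      (Nat.sub (Nat.succ n) (Nat.land (Nat.succ n) n))) s) fuel

/-- Test that the set `s` contains no `k + 1` pairwise adjacent vertices, where `w` and `w'` are the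
neighbourhood words at even and odd positions of `s`. -/
def noClique (k : ℕ) : ℕ → ℕ → ℕ → Bool :=
  Nat.rec (fun _ _ s => Nat.beq s 0) (fun _ next => scan next 184) k

/-- `T` is a clique inside the set `s` placed at offset `o`, where `x < y` are adjacent when the
word `W x` has digit `y - x`. -/
structure IsWordClique (W : ℕ → ℕ) (o s : ℕ) (T : Finset ℕ) : Prop where
  mem : ∀ x ∈ T, o ≤ x ∧ s.testBit (x - o) = true
  adj : ∀ x ∈ T, ∀ y ∈ T, x < y → (W x).testBit (y - x) = true

theorem succ_land_self_of_eq {n v q : ℕ} (h : n + 1 = 2 ^ v * (2 * q + 1)) :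
    Nat.land (n + 1) n = 2 ^ v * (2 * q) := by
  have hv : 0 < 2 ^ v := by positivity
  have hn : n = 2 ^ v * (2 * q) + (2 ^ v - 1) := by
    rw [mul_add, mul_one] at h; omega
  change (n + 1) &&& n = _
  apply Nat.eq_of_testBit_eq
  intro i
  rw [Nat.testBit_and, h, hn, Nat.testBit_two_pow_mul_add _ (by omega), Nat.testBit_two_pow_mul,
    Nat.testBit_two_pow_mul]
  by_cases hi : i < v
  · simp [hi, Nat.not_le.2 hi]
  · rw [if_neg hi]
    rcases hj : i - v with _ | j
    · simp
    · simp [Nat.testBit_succ, Nat.not_lt.1 hi]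
      intro hq
      have h2 : (2 * q + 1) / 2 = q := by omega
      rwa [h2]

theorem two_pow_mod_three (v : ℕ) : 2 ^ v % 3 = if v % 2 = 0 then 1 else 2 := by
  induction v with
  | zero => rfl
  | succ v ih =>
    rw [pow_succ, Nat.mul_mod, ih]
    rcases Nat.mod_two_eq_zero_or_one v with h | h <;> simp [h, Nat.add_mod]

theorem eq_of_mod_two_eq {W : ℕ → ℕ} (hW : ∀ i, W (i + 2) = W i) {i j : ℕ}
    (h : i % 2 = j % 2) : W i = W j := by
  have key : ∀ m c, W (c + 2 * m) = W c := by
    intro m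
    induction m with
    | zero => intro c; rfl
    | succ m ih => intro c; rw [show c + 2 * (m + 1) = c + 2 * m + 2 by ring, hW, ih]
  rw [← Nat.mod_add_div i 2, ← Nat.mod_add_div j 2, key, key, h]

theorem lowestBranch_eq {W : ℕ → ℕ} (hW : ∀ i, W (i + 2) = W i) {next ih : ℕ → ℕ → ℕ → Bool}
    {o n v q : ℕ} (h : n + 1 = 2 ^ v * (2 * q + 1)) :
    lowestBranch next ih (W o) (W (o + 1)) (Nat.land (n + 1) n)
      (Nat.sub (n + 1) (Nat.land (n + 1) n)) =
      branch next ih (2 * q) (W (o + v)) (W (o + v + 1)) := by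
  have hv : 0 < 2 ^ v := by positivity
  have hb : Nat.sub (n + 1) (2 ^ v * (2 * q)) = 2 ^ v := by
    change n + 1 - _ = _
    rw [h, mul_add, mul_one, Nat.add_sub_cancel_left]
  have hd : Nat.div (2 ^ v * (2 * q)) (2 ^ v) = 2 * q := Nat.mul_div_cancel_left _ hv
  have hm : Nat.mod (2 ^ v) 3 = if v % 2 = 0 then 1 else 2 := two_pow_mod_three v
  rw [succ_land_self_of_eq h, hb, lowestBranch, hd, hm]
  rcases Nat.mod_two_eq_zero_or_one v with hv2 | hv2
  · rw [eq_of_mod_two_eq hW (show (o + v) % 2 = o % 2 by omega),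
      eq_of_mod_two_eq hW (show (o + v + 1) % 2 = (o + 1) % 2 by omega), if_pos hv2]
    rfl
  · rw [eq_of_mod_two_eq hW (show (o + v) % 2 = (o + 1) % 2 by omega),
      eq_of_mod_two_eq hW (show (o + v + 1) % 2 = o % 2 by omega), if_neg (by omega)]
    rfl

theorem branch_eq_true {next ih : ℕ → ℕ → ℕ → Bool} {q w w' : ℕ}
    (h : branch next ih q w w' = true) :
    next w w' (q &&& w) = true ∧ ih w w' q = true := by
  unfold branch at h
  change Bool.rec false (ih w w' q) (next w w' (q &&& w)) = true at h
  cases hn : next w w' (q &&& w) <;> simp_all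

theorem testBit_two_pow_mul_odd {v q i : ℕ}
    (h : (2 ^ v * (2 * q + 1)).testBit i = true) (hi : i ≠ v) :
    v ≤ i ∧ (2 * q).testBit (i - v) = true := by
  rw [Nat.testBit_two_pow_mul] at h
  simp only [Bool.and_eq_true, decide_eq_true_eq] at h
  refine ⟨h.1, ?_⟩
  obtain ⟨j, hj⟩ : ∃ j, i - v = j + 1 := ⟨i - v - 1, by omega⟩
  rw [hj, Nat.testBit_succ] at h ⊢
  rw [show (2 * q + 1) / 2 = q by omega] at h
  rw [show 2 * q / 2 = q by omega]
  exact h.2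

theorem scan_sound {W : ℕ → ℕ} (hW : ∀ i, W (i + 2) = W i) {next : ℕ → ℕ → ℕ → Bool} {k : ℕ}
    (hnext : ∀ o s, next (W o) (W (o + 1)) s = true →
      ∀ T : Finset ℕ, T.card = k → ¬ IsWordClique W o s T)
    (fuel o s : ℕ) (h : scan next fuel (W o) (W (o + 1)) s = true)
    (T : Finset ℕ) (hT : T.card = k + 1) : ¬ IsWordClique W o s T := by
  induction fuel generalizing o s with
  | zero => exact absurd h Bool.false_ne_true
  | succ fuel ih =>
    intro hc
    rcases s with _ | n
    · obtain ⟨x, hx⟩ : T.Nonempty := Finset.card_pos.1 (by omega)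
      simpa using (hc.mem x hx).2
    obtain ⟨v, m, ⟨q, rfl⟩, hn⟩ := Nat.exists_eq_two_pow_mul_odd (Nat.succ_ne_zero n)
    change lowestBranch next (scan next fuel) (W o) (W (o + 1)) (Nat.land (n + 1) n)
      (Nat.sub (n + 1) (Nat.land (n + 1) n)) = true at h
    rw [lowestBranch_eq hW hn] at h
    obtain ⟨hfirst, hrest⟩ := branch_eq_true h
    have hmem : ∀ x ∈ T, x ≠ o + v → o + v ≤ x ∧ (2 * q).testBit (x - (o + v)) = true := by
      intro x hx hne
      obtain ⟨hox, hbit⟩ := hc.mem x hx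
      rw [Nat.succ_eq_add_one] at hn
      rw [hn] at hbit
      obtain ⟨hle, hbit⟩ := testBit_two_pow_mul_odd hbit (by omega)
      exact ⟨by omega, by rwa [← Nat.sub_sub]⟩
    by_cases hv : o + v ∈ T
    · refine hnext _ _ hfirst (T.erase (o + v)) (by rw [Finset.card_erase_of_mem hv, hT]; rfl)
        ⟨fun x hx => ?_, fun x hx y hy => hc.adj x (Finset.mem_of_mem_erase hx) y
          (Finset.mem_of_mem_erase hy)⟩
      obtain ⟨hne, hx⟩ := Finset.mem_erase.1 hx
      obtain ⟨hle, hbit⟩ := hmem x hx hne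
      exact ⟨hle, by rw [Nat.testBit_and, hbit, hc.adj _ hv x hx (by omega)]; rfl⟩
    · exact ih _ _ hrest ⟨fun x hx => hmem x hx (ne_of_mem_of_not_mem hx hv), hc.adj⟩

theorem noClique_sound {W : ℕ → ℕ} (hW : ∀ i, W (i + 2) = W i) (k o s : ℕ)
    (h : noClique k (W o) (W (o + 1)) s = true) (T : Finset ℕ) (hT : T.card = k + 1) :
    ¬ IsWordClique W o s T := by
  induction k generalizing o s T with
  | zero =>
    intro hc
    have hs : s = 0 := Nat.eq_of_beq_eq_true h
    obtain ⟨x, hx⟩ : T.Nonempty := Finset.card_pos.1 (by omega)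
    simpa [hs] using (hc.mem x hx).2
  | succ k ih => exact scan_sound hW ih 184 o s h T hT

/-- Test that no `k + 2` pairwise adjacent vertices of `s` have their least element in
`[a, a + n)`. -/
def noCliqueFrom (W : ℕ → ℕ) (k s a n : ℕ) : Bool :=
  (List.range' a n).all fun v =>
    !s.testBit v || noClique k (W v) (W (v + 1)) ((s >>> v) &&& W v)

theorem noCliqueFrom_append {W : ℕ → ℕ} {k s a b l m n : ℕ}
    (h₁ : noCliqueFrom W k s a m = true) (h₂ : noCliqueFrom W k s b n = true)
    (hb : b = a + m) (hl : l = m + n) : noCliqueFrom W k s a l = true := by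
  subst hb hl
  unfold noCliqueFrom at *
  rw [← List.range'_append_1, List.all_append, h₁, h₂]
  rfl

theorem noCliqueFrom_sound {W : ℕ → ℕ} (hW : ∀ i, W (i + 2) = W i) {k s n : ℕ}
    (h : noCliqueFrom W k s 0 n = true) {T : Finset ℕ} (hT : T.card = k + 2)
    (hlt : ∀ x ∈ T, x < n) : ¬ IsWordClique W 0 s T := by
  intro hc
  have hne : T.Nonempty := Finset.card_pos.1 (by omega)
  have hv := T.min'_mem hne
  set v := T.min' hne with hvdef
  have hbit : s.testBit v = true := (hc.mem v hv).2
  have hcheck := List.all_eq_true.1 h v (by simpa [List.mem_range'_1] using hlt v hv)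
  rw [hbit, Bool.not_true, Bool.false_or] at hcheck
  refine noClique_sound hW k v _ hcheck (T.erase v)
    (by rw [Finset.card_erase_of_mem hv, hT]; rfl)
    ⟨fun x hx => ?_, fun x hx y hy => hc.adj x (Finset.mem_of_mem_erase hx) y
      (Finset.mem_of_mem_erase hy)⟩
  obtain ⟨hxv, hx⟩ := Finset.mem_erase.1 hx
  have hle : v ≤ x := T.min'_le x hx
  refine ⟨hle, ?_⟩
  have hsx : s.testBit x = true := (hc.mem x hx).2
  rw [Nat.testBit_and, Nat.testBit_shiftRight, Nat.add_sub_cancel' hle, hsx,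
    hc.adj v hv x hx (by omega)]
  rfl

/-- The cyclic difference `v - u` modulo `184`, as a natural number. -/
def cyclicDiff (u v : Fin 184) : ℕ := (v.val + 184 - u.val) % 184

theorem cyclicDiff_injective (u : Fin 184) : Function.Injective (cyclicDiff u) := by
  intro v w h
  unfold cyclicDiff at h
  ext
  omega

theorem cyclicDiff_sub {u v w : Fin 184} (h : cyclicDiff u v < cyclicDiff u w) :
    cyclicDiff u w - cyclicDiff u v = cyclicDiff v w := by
  unfold cyclicDiff at *
  omega

/-- Translating a clique so that its vertex `u` moves to `0` yields a clique of words. -/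
theorem isWordClique_image {G : SimpleGraph (Fin 184)} {W : ℕ → ℕ}
    (hW : ∀ i, W (i + 2) = W i)
    (hG : ∀ u v, G.Adj u v → (W u).testBit (cyclicDiff u v) = true)
    {T : Finset (Fin 184)} (hT : G.IsClique T) {u : Fin 184} (hu : u ∈ T) {c : ℕ}
    (hc : u.val % 2 = c) :
    IsWordClique (fun i => W (i + c)) 0 (W c) ((T.erase u).image (cyclicDiff u)) := by
  subst hc
  constructor
  · intro x hx
    obtain ⟨v, hv, rfl⟩ := Finset.mem_image.1 hx
    obtain ⟨hne, hv⟩ := Finset.mem_erase.1 hv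
    refine ⟨Nat.zero_le _, ?_⟩
    rw [eq_of_mod_two_eq hW (Nat.mod_mod _ _)]
    exact hG u v (hT hu hv hne.symm)
  · intro x hx y hy hxy
    obtain ⟨v, hv, rfl⟩ := Finset.mem_image.1 hx
    obtain ⟨w, hw, rfl⟩ := Finset.mem_image.1 hy
    have hne : v ≠ w := by rintro rfl; exact lt_irrefl _ hxy
    rw [cyclicDiff_sub hxy,
      eq_of_mod_two_eq hW (show (cyclicDiff u v + u.val % 2) % 2 = v.val % 2 by
        unfold cyclicDiff; omega)]
    exact hG v w (hT (Finset.mem_of_mem_erase hv) (Finset.mem_of_mem_erase hw) hne)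

/-- The set of even numbers below `184`. -/
def evenWord : ℕ := 8173309551284740577911184144801648979299941984979211605

theorem testBit_evenWord : ∀ i < 184, i % 2 = 0 → evenWord.testBit i = true := by
  decide +kernel

theorem cliqueFree_of_noCliqueFrom {G : SimpleGraph (Fin 184)} {W : ℕ → ℕ}
    (hW : ∀ i, W (i + 2) = W i)
    (hG : ∀ u v, G.Adj u v → (W u).testBit (cyclicDiff u v) = true) {k : ℕ}
    (h₀ : noCliqueFrom W k (W 0) 0 184 = true)
    (h₁ : noCliqueFrom (fun i => W (i + 1)) k (W 1 &&& evenWord) 0 184 = true) :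
    G.CliqueFree (k + 3) := by
  rintro T ⟨hT, hcard⟩
  have himage : ∀ u ∈ T, ((T.erase u).image (cyclicDiff u)).card = k + 2 := fun u hu => by
    rw [Finset.card_image_of_injective _ (cyclicDiff_injective u), Finset.card_erase_of_mem hu,
      hcard]
    rfl
  have hlt : ∀ u, ∀ x ∈ (T.erase u).image (cyclicDiff u), x < 184 := fun u x hx => by
    obtain ⟨v, -, rfl⟩ := Finset.mem_image.1 hx
    exact Nat.mod_lt _ (by norm_num)
  by_cases heven : ∃ u ∈ T, u.val % 2 = 0
  · obtain ⟨u, hu, hu2⟩ := heven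
    exact noCliqueFrom_sound hW h₀ (himage u hu) (hlt u) (isWordClique_image hW hG hT hu hu2)
  · push Not at heven
    obtain ⟨u, hu⟩ : T.Nonempty := Finset.card_pos.1 (by omega)
    have hc := isWordClique_image hW hG hT hu (c := 1) (by have := heven u hu; omega)
    refine noCliqueFrom_sound (W := fun i => W (i + 1)) (fun i => hW (i + 1)) h₁ (himage u hu)
      (hlt u) ⟨fun x hx => ⟨Nat.zero_le _, ?_⟩, hc.adj⟩
    rw [Nat.testBit_and, (hc.mem x hx).2, Bool.true_and]
    refine testBit_evenWord _ (hlt u x hx) ?_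
    obtain ⟨v, hv, rfl⟩ := Finset.mem_image.1 hx
    have h1 := heven u hu
    have h2 := heven v (Finset.mem_of_mem_erase hv)
    unfold cyclicDiff
    omega

/-- The cyclic differences from a vertex to its neighbours, by parity of the vertex. -/
def adjWord (i : ℕ) : ℕ :=
  if i % 2 = 0 then 18668497469481208760780879560452135650884524356053118598
  else 12538515306023206735575641188619601857853197495954452098

/-- The cyclic differences from a vertex to its non-neighbours, by parity of the vertex. -/
def nonadjWord (i : ℕ) : ℕ :=
  if i % 2 = 0 then 5851431184373012972952672873952811287015301598884516216
  else 11981413347831014998157911245785345080046628458983182716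

theorem adjWord_add_two (i : ℕ) : adjWord (i + 2) = adjWord i := by
  simp [adjWord]

theorem nonadjWord_add_two (i : ℕ) : nonadjWord (i + 2) = nonadjWord i := by
  simp [nonadjWord]

theorem testBit_adjWord_neg : ∀ c < 2, ∀ d < 184, (adjWord c).testBit d = true →
    (adjWord (c + d)).testBit ((184 - d) % 184) = true := by
  decide +kernel

theorem testBit_adjWord_or_nonadjWord : ∀ c < 2, ∀ d < 184, d = 0 ∨
    (adjWord c).testBit d = true ∨ (nonadjWord c).testBit d = true := by
  decide +kernel

theorem not_testBit_adjWord_zero : ∀ c < 2, (adjWord c).testBit 0 = false := by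
  decide +kernel

/-- A graph on `184` vertices without `6` pairwise adjacent or `10` pairwise non-adjacent
vertices. -/
def ramseyGraph : SimpleGraph (Fin 184) where
  Adj u v := (adjWord u).testBit (cyclicDiff u v) = true
  symm := ⟨fun u v h => by
    have hlt : cyclicDiff u v < 184 := Nat.mod_lt _ (by norm_num)
    rw [← eq_of_mod_two_eq adjWord_add_two (Nat.mod_mod u.val 2)] at h
    have hneg := testBit_adjWord_neg _ (Nat.mod_lt _ (by norm_num)) _ hlt h
    rw [eq_of_mod_two_eq adjWord_add_two
      (show (u.val % 2 + cyclicDiff u v) % 2 = v.val % 2 by unfold cyclicDiff; omega),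
      show (184 - cyclicDiff u v) % 184 = cyclicDiff v u by unfold cyclicDiff; omega] at hneg
    exact hneg⟩
  loopless := ⟨fun u h => by
    rw [← eq_of_mod_two_eq adjWord_add_two (Nat.mod_mod u.val 2),
      show cyclicDiff u u = 0 by unfold cyclicDiff; omega,
      not_testBit_adjWord_zero _ (Nat.mod_lt _ (by norm_num))] at h
    exact Bool.false_ne_true h⟩

theorem nonadjWord_of_compl_adj (u v : Fin 184) (huv : ramseyGraphᶜ.Adj u v) :
    (nonadjWord u).testBit (cyclicDiff u v) = true := by
  rw [SimpleGraph.compl_adj] at huv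
  have h := testBit_adjWord_or_nonadjWord _ (Nat.mod_lt u.val (by norm_num)) (cyclicDiff u v)
    (Nat.mod_lt _ (by norm_num))
  rw [eq_of_mod_two_eq adjWord_add_two (Nat.mod_mod u.val 2),
    eq_of_mod_two_eq nonadjWord_add_two (Nat.mod_mod u.val 2)] at h
  have hne : cyclicDiff u v ≠ 0 := fun h0 => huv.1 (by unfold cyclicDiff at h0; ext; omega)
  exact (h.resolve_left hne).resolve_left huv.2

theorem adj_even : noCliqueFrom adjWord 3 (adjWord 0) 0 184 = true := by
  decide +kernel

theorem adj_odd :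
    noCliqueFrom (fun i => adjWord (i + 1)) 3 (adjWord 1 &&& evenWord) 0 184 = true := by
  decide +kernel

theorem nonadj_even_from_0 : noCliqueFrom nonadjWord 7 (nonadjWord 0) 0 6 = true := by
  decide +kernel

theorem nonadj_even_from_6 : noCliqueFrom nonadjWord 7 (nonadjWord 0) 6 8 = true := by
  decide +kernel

theorem nonadj_even_from_14 : noCliqueFrom nonadjWord 7 (nonadjWord 0) 14 12 = true := by
  decide +kernel

theorem nonadj_even_from_26 : noCliqueFrom nonadjWord 7 (nonadjWord 0) 26 158 = true := by
  decide +kernel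

theorem nonadj_even : noCliqueFrom nonadjWord 7 (nonadjWord 0) 0 184 = true := by
  have h14 := noCliqueFrom_append (l := 14) nonadj_even_from_0 nonadj_even_from_6 rfl rfl
  have h26 := noCliqueFrom_append (l := 26) h14 nonadj_even_from_14 rfl rfl
  exact noCliqueFrom_append h26 nonadj_even_from_26 rfl rfl

theorem nonadj_odd :
    noCliqueFrom (fun i => nonadjWord (i + 1)) 7 (nonadjWord 1 &&& evenWord) 0 184 = true := by
  decide +kernel

theorem ramseyGraph_cliqueFree : ramseyGraph.CliqueFree 6 :=
  cliqueFree_of_noCliqueFrom adjWord_add_two (fun _ _ h => h) adj_even adj_odd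

theorem ramseyGraph_compl_cliqueFree : ramseyGraphᶜ.CliqueFree 10 :=
  cliqueFree_of_noCliqueFrom nonadjWord_add_two nonadjWord_of_compl_adj nonadj_even nonadj_odd

theorem ramsey_lower_bound_R_6_10 :
    ∃ G : SimpleGraph (Fin 184), G.CliqueFree 6 ∧ Gᶜ.CliqueFree 10 := by
  exact ⟨ramseyGraph, ramseyGraph_cliqueFree, ramseyGraph_compl_cliqueFree⟩
end
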